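/- arXiv:math/0202075 — 3 statements merged into one kernel-verified Lean document; each statement's English description precedes it below -/
import Mathlib

section
/- Let r ≥ 2, n = 2r, L > 0, and let f : ℝ → ℝ be C² with f(0) = L/2 and f′(0) = 0. Define 𝓛 : (ZMod n → ℝ) → ℝ by 𝓛(x) = Σ_{j ∈ ZMod n} sqrt((x_{j+1} − x_j)² + (f(x_j) + f(x_{j+1}))²). Then 𝓛 is twice differentiable at 0, the point 0 is a critical point of 𝓛 (the first derivative of 𝓛 at 0 vanishes), and the second-order partial derivatives at 0 are: ∂²𝓛/∂x_j∂x_k(0) = (2 + 2L·f″(0))/L if k = j; −1/L if k = j+1 or k = j−1 in ZMod n; and 0 otherwise. Equivalently, the Hessian matrix of 𝓛 at 0 equals (1/L) times the circulant matrix with first row (2 + 2L·f″(0), −1, 0, …, 0, −1). -/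
open Filter Topology

/-- First derivative of the distance between `(a, f a)` and `(b, - f b)` along a curve. -/
theorem hasDerivAt_chord {f a b : ℝ → ℝ} (hf : Differentiable ℝ f) {a' b' t : ℝ}
    (ha : HasDerivAt a a' t) (hb : HasDerivAt b b' t)
    (h : (b t - a t) ^ 2 + (f (a t) + f (b t)) ^ 2 ≠ 0) :
    HasDerivAt (fun s => Real.sqrt ((b s - a s) ^ 2 + (f (a s) + f (b s)) ^ 2))
      (((b t - a t) * (b' - a') + (f (a t) + f (b t)) *
        (deriv f (a t) * a' + deriv f (b t) * b')) /
        Real.sqrt ((b t - a t) ^ 2 + (f (a t) + f (b t)) ^ 2)) t := by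
  have hfa := (hf (a t)).hasDerivAt.comp t ha
  have hfb := (hf (b t)).hasDerivAt.comp t hb
  have key := (((hb.sub ha).pow 2).add ((hfa.add hfb).pow 2)).sqrt h
  refine key.congr_deriv ?_
  simp only [Pi.sub_apply, Pi.add_apply, Function.comp_apply, Nat.cast_ofNat,
    Nat.add_one_sub_one, pow_one, Pi.pow_apply]
  rw [← mul_div_mul_left _ _ (two_ne_zero' ℝ)]
  ring

/-- Second derivative of the chord length, at the bouncing ball orbit. -/
theorem hasDerivAt_deriv_chord {f : ℝ → ℝ} (hf : Differentiable ℝ f)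
    (hf' : DifferentiableAt ℝ (deriv f) 0) {L : ℝ} (hL : 0 < L) (hf0 : f 0 = L / 2)
    (hf'0 : deriv f 0 = 0) (a b a' b' : ℝ) :
    HasDerivAt (fun s => ((s * b - s * a) * (b' - a') + (f (s * a) + f (s * b)) *
        (deriv f (s * a) * a' + deriv f (s * b) * b')) /
        Real.sqrt ((s * b - s * a) ^ 2 + (f (s * a) + f (s * b)) ^ 2))
      ((b - a) * (b' - a') / L + deriv (deriv f) 0 * (a * a' + b * b')) 0 := by
  have ha : HasDerivAt (fun s : ℝ => s * a) a 0 := by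
    simpa using (hasDerivAt_id (0 : ℝ)).mul_const a
  have hb : HasDerivAt (fun s : ℝ => s * b) b 0 := by
    simpa using (hasDerivAt_id (0 : ℝ)).mul_const b
  have hQ : ((0 : ℝ) * b - 0 * a) ^ 2 + (f (0 * a) + f (0 * b)) ^ 2 = L ^ 2 := by
    simp only [zero_mul, hf0]; ring
  have hsqrt := hasDerivAt_chord hf ha hb (by rw [hQ]; positivity)
  have hfa : HasDerivAt (fun s => f (s * a)) (deriv f (0 * a) * a) 0 :=
    (hf (0 * a)).hasDerivAt.comp 0 ha
  have hfb : HasDerivAt (fun s => f (s * b)) (deriv f (0 * b) * b) 0 :=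
    (hf (0 * b)).hasDerivAt.comp 0 hb
  have hfa' : HasDerivAt (fun s => deriv f (s * a)) (deriv (deriv f) 0 * a) 0 :=
    HasDerivAt.comp (h₂ := deriv f) 0 (by simpa using hf'.hasDerivAt) ha
  have hfb' : HasDerivAt (fun s => deriv f (s * b)) (deriv (deriv f) 0 * b) 0 :=
    HasDerivAt.comp (h₂ := deriv f) 0 (by simpa using hf'.hasDerivAt) hb
  have key := (((hb.sub ha).mul_const (b' - a')).add ((hfa.add hfb).mul
    ((hfa'.mul_const a').add (hfb'.mul_const b')))).div hsqrt
    (by rw [hQ, Real.sqrt_sq hL.le]; exact hL.ne')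
  refine key.congr_deriv ?_
  rw [hQ, Real.sqrt_sq hL.le]
  simp only [Pi.sub_apply, Pi.add_apply, Pi.mul_apply, zero_mul, hf0, hf'0]
  field_simp
  ring

theorem contDiffAt_chord {ι : Type*} [Fintype ι] {f : ℝ → ℝ} (hf : ContDiff ℝ 2 f)
    {x : ι → ℝ} (i k : ι) (h : (x k - x i) ^ 2 + (f (x i) + f (x k)) ^ 2 ≠ 0) :
    ContDiffAt ℝ 2
      (fun x : ι → ℝ => Real.sqrt ((x k - x i) ^ 2 + (f (x i) + f (x k)) ^ 2)) x := by
  refine ContDiffAt.sqrt ?_ h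
  have hi : ContDiff ℝ 2 (fun x : ι → ℝ => x i) := contDiff_apply ℝ ℝ i
  have hk : ContDiff ℝ 2 (fun x : ι → ℝ => x k) := contDiff_apply ℝ ℝ k
  exact (((hk.sub hi).pow 2).add (((hf.comp hi).add (hf.comp hk)).pow 2)).contDiffAt

theorem DifferentiableAt.hasDerivAt_line {E : Type*} [NormedAddCommGroup E] [NormedSpace ℝ E]
    {F : E → ℝ} {x : E} (hF : DifferentiableAt ℝ F x) (v : E) :
    HasDerivAt (fun t : ℝ => F (x + t • v)) (fderiv ℝ F x v) 0 :=
  hF.hasFDerivAt.hasLineDerivAt v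

/-- The bilinear form with circulant matrix, evaluated at basis vectors. -/
theorem sum_circulant_single {n : ℕ} [NeZero n] (hn : 3 ≤ n) (L c : ℝ) (hL : L ≠ 0)
    (j k : ZMod n) :
    ∑ i : ZMod n, (((Pi.single j 1 : ZMod n → ℝ) (i + 1) - (Pi.single j 1 : ZMod n → ℝ) i) *
        ((Pi.single k 1 : ZMod n → ℝ) (i + 1) - (Pi.single k 1 : ZMod n → ℝ) i) / L +
      c * ((Pi.single j 1 : ZMod n → ℝ) i * (Pi.single k 1 : ZMod n → ℝ) i +
        (Pi.single j 1 : ZMod n → ℝ) (i + 1) * (Pi.single k 1 : ZMod n → ℝ) (i + 1))) =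
      if k = j then (2 + 2 * L * c) / L
      else if k = j + 1 ∨ k = j - 1 then -1 / L
      else 0 := by
  set w : ZMod n → ℝ := Pi.single j 1 with hw
  set v : ZMod n → ℝ := Pi.single k 1 with hv
  have h1 (u : ZMod n → ℝ) : ∑ i, w i * u i = u j := by
    simp [hw, Pi.single_apply]
  have h2 (u : ZMod n → ℝ) : ∑ i, w (i + 1) * u (i + 1) = u j := by
    rw [← h1 u]
    exact Equiv.sum_comp (Equiv.addRight (1 : ZMod n)) (fun i => w i * u i)
  have h3 : ∑ i, w (i + 1) * v i = v (j - 1) := by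
    simpa using h2 (fun i => v (i - 1))
  have h4 : ∑ i, w i * v (i + 1) = v (j + 1) := h1 (fun i => v (i + 1))
  have hsum : ∑ i, ((w (i + 1) - w i) * (v (i + 1) - v i) / L +
      c * (w i * v i + w (i + 1) * v (i + 1))) =
      (1 / L + c) * ∑ i, w (i + 1) * v (i + 1) + (1 / L + c) * ∑ i, w i * v i
        - 1 / L * ∑ i, w (i + 1) * v i - 1 / L * ∑ i, w i * v (i + 1) := by
    simp only [Finset.mul_sum, ← Finset.sum_add_distrib, ← Finset.sum_sub_distrib]
    exact Finset.sum_congr rfl fun i _ => by ring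
  have hone : (1 : ZMod n) ≠ 0 := by
    intro h
    have := (ZMod.natCast_eq_zero_iff 1 n).1 (by simpa using h)
    exact absurd (Nat.le_of_dvd one_pos this) (by omega)
  have htwo : (1 : ZMod n) + 1 ≠ 0 := by
    intro h
    have := (ZMod.natCast_eq_zero_iff 2 n).1 (by rw [← h]; norm_num)
    exact absurd (Nat.le_of_dvd two_pos this) (by omega)
  have hne : j + 1 ≠ j - 1 := fun h => htwo (by linear_combination h)
  rw [hsum, h2 v, h1 v, h3, h4]
  simp only [hv, Pi.single_apply]
  by_cases hkj : k = j
  · subst hkj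
    simp [hone]
    field_simp
    ring
  · by_cases hk1 : k = j + 1
    · subst hk1
      simp [hone, hne.symm]
      ring
    · by_cases hk2 : k = j - 1
      · subst hk2
        simp [hone, hne, Ne.symm hkj]
        ring
      · simp [hkj, hk1, hk2, Ne.symm hkj, Ne.symm hk1, Ne.symm hk2]


theorem stmt4 (r : ℕ) (hr : 2 ≤ r) (n : ℕ) (hn : n = 2 * r) [NeZero n]
    (L : ℝ) (hL : 0 < L) (f : ℝ → ℝ) (hf : ContDiff ℝ 2 f)
    (hf0 : f 0 = L / 2) (hf'0 : deriv f 0 = 0)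
    (𝓛 : (ZMod n → ℝ) → ℝ)
    (h𝓛 : ∀ x : ZMod n → ℝ, 𝓛 x = ∑ j : ZMod n,
      Real.sqrt ((x (j + 1) - x j) ^ 2 + (f (x j) + f (x (j + 1))) ^ 2)) :
    ContDiffAt ℝ 2 𝓛 0 ∧ fderiv ℝ 𝓛 0 = 0 ∧
      ∀ j k : ZMod n,
        fderiv ℝ (fun x => fderiv ℝ 𝓛 x (Pi.single k 1)) 0 (Pi.single j 1) =
          if k = j then (2 + 2 * L * deriv (deriv f) 0) / L
          else if k = j + 1 ∨ k = j - 1 then -1 / L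
          else 0 := by
  obtain rfl : 𝓛 = fun x : ZMod n → ℝ => ∑ j : ZMod n,
      Real.sqrt ((x (j + 1) - x j) ^ 2 + (f (x j) + f (x (j + 1))) ^ 2) := funext h𝓛
  have hfd : Differentiable ℝ f := hf.differentiable (by norm_num)
  have hf'd : Differentiable ℝ (deriv f) :=
    ((contDiff_succ_iff_deriv (n := 1)).1 hf).2.2.differentiable (by norm_num)
  set F : (ZMod n → ℝ) → ℝ := fun x => ∑ j : ZMod n,
      Real.sqrt ((x (j + 1) - x j) ^ 2 + (f (x j) + f (x (j + 1))) ^ 2) with hF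
  have hne0 (i : ZMod n) : ((0 : ZMod n → ℝ) (i + 1) - (0 : ZMod n → ℝ) i) ^ 2 +
      (f ((0 : ZMod n → ℝ) i) + f ((0 : ZMod n → ℝ) (i + 1))) ^ 2 ≠ 0 := by
    simp only [Pi.zero_apply, hf0, sub_zero]
    positivity
  have hC : ContDiffAt ℝ 2 F 0 :=
    ContDiffAt.sum fun i _ => contDiffAt_chord hf i (i + 1) (hne0 i)
  have hne : ∀ᶠ x : ZMod n → ℝ in 𝓝 0, ∀ i : ZMod n,
      (x (i + 1) - x i) ^ 2 + (f (x i) + f (x (i + 1))) ^ 2 ≠ 0 := by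
    refine eventually_all.2 fun i => ContinuousAt.eventually_ne ?_ (hne0 i)
    have := hf.continuous
    fun_prop
  have hD1 (x : ZMod n → ℝ) (hx : ∀ i : ZMod n,
      (x (i + 1) - x i) ^ 2 + (f (x i) + f (x (i + 1))) ^ 2 ≠ 0) (v : ZMod n → ℝ) :
      fderiv ℝ F x v = ∑ i, ((x (i + 1) - x i) * (v (i + 1) - v i) + (f (x i) + f (x (i + 1))) *
        (deriv f (x i) * v i + deriv f (x (i + 1)) * v (i + 1))) /
        Real.sqrt ((x (i + 1) - x i) ^ 2 + (f (x i) + f (x (i + 1))) ^ 2) := by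
    have hFx : DifferentiableAt ℝ F x :=
      (ContDiffAt.sum fun i _ => contDiffAt_chord hf i (i + 1) (hx i) :
        ContDiffAt ℝ 2 F x).differentiableAt (by norm_num)
    refine (hFx.hasDerivAt_line v).unique ?_
    refine HasDerivAt.fun_sum fun i _ => ?_
    have hc (m : ZMod n) : HasDerivAt (fun t : ℝ => (x + t • v) m) (v m) 0 := by
      simpa using ((hasDerivAt_id (0 : ℝ)).mul_const (v m)).const_add (x m)
    simpa using hasDerivAt_chord hfd (hc i) (hc (i + 1)) (by simpa using hx i)
  refine ⟨hC, ?_, fun j k => ?_⟩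
  · ext1 v
    simp [hD1 0 hne0 v, hf'0]
  · rw [← sum_circulant_single (by omega) L (deriv (deriv f) 0) hL.ne' j k]
    have hG : DifferentiableAt ℝ (fun x => fderiv ℝ F x (Pi.single k 1)) 0 :=
      ((hC.fderiv_right (m := 1) (by norm_num)).differentiableAt (by norm_num)).clm_apply
        (differentiableAt_const _)
    have hev : (fun x => fderiv ℝ F x (Pi.single k 1)) =ᶠ[𝓝 0] _ :=
      hne.mono fun x hx => hD1 x hx (Pi.single k 1)
    rw [hev.fderiv_eq]
    refine ((hG.congr_of_eventuallyEq hev.symm).hasDerivAt_line _).unique ?_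
    refine HasDerivAt.fun_sum fun i _ => ?_
    simpa only [zero_add, Pi.smul_apply, smul_eq_mul] using
      hasDerivAt_deriv_chord hfd (hf'd 0) hL hf0 hf'0 ((Pi.single j 1 : ZMod n → ℝ) i)
        ((Pi.single j 1 : ZMod n → ℝ) (i + 1)) ((Pi.single k 1 : ZMod n → ℝ) i)
        ((Pi.single k 1 : ZMod n → ℝ) (i + 1))
end

section
/- Let n ≥ 3 and c ∈ ℝ with c > 1, and let v : ZMod n → ℝ be the vector with v 0 = 2c, v 1 = 1, v (−1) = 1, and v j = 0 for all other j. Then Matrix.circulant v is a symmetric positive definite matrix; in particular it is invertible. -/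
/-- With `w = e₀ + e₁`, the Gram matrix of `Matrix.circulant w` is circulant with vector
`2 e₀ + e₁ + e₋₁`. -/
lemma conjTranspose_mul_circulant_single_add_single (n : ℕ) [NeZero n] :
    (Matrix.circulant (Pi.single 0 1 + Pi.single 1 1 : ZMod n → ℝ)).conjTranspose *
      Matrix.circulant (Pi.single 0 1 + Pi.single 1 1 : ZMod n → ℝ) =
      Matrix.circulant (Pi.single 0 2 + Pi.single 1 1 + Pi.single (-1) 1) := by
  rw [Matrix.conjTranspose_circulant, Matrix.circulant_mul]
  congr 1
  ext j
  have hj : j - 1 = -1 ↔ j = 0 := by simp [sub_eq_iff_eq_add]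
  simp only [Matrix.mulVec_add, Matrix.mulVec_single_one, Pi.add_apply, Matrix.col_apply,
    Matrix.circulant_apply, star_trivial, Pi.single_apply, sub_zero, neg_eq_iff_eq_neg, neg_zero,
    sub_eq_zero, hj]
  split_ifs <;> norm_num

theorem stmt6 (n : ℕ) (hn : 3 ≤ n) [NeZero n] (c : ℝ) (hc : 1 < c)
    (v : ZMod n → ℝ) (hv0 : v 0 = 2 * c) (hv1 : v 1 = 1) (hvm : v (-1) = 1)
    (hv : ∀ j : ZMod n, j ≠ 0 → j ≠ 1 → j ≠ -1 → v j = 0) :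
    (Matrix.circulant v).PosDef ∧ IsUnit (Matrix.circulant v) := by
  have : Fact (1 < n) := ⟨by omega⟩
  have : Fact (2 < n) := ⟨by omega⟩
  have h : (1 : ZMod n) ≠ -1 := (ZMod.neg_one_ne_one (n := n)).symm
  have hvec : v = Pi.single 0 (2 * c - 2) +
      (Pi.single 0 2 + Pi.single 1 1 + Pi.single (-1) 1) := by
    ext j
    by_cases h0 : j = 0
    · subst h0
      simp [hv0]
    by_cases h1 : j = 1
    · subst h1
      simp [hv1, h]
    by_cases h2 : j = -1
    · subst h2
      simp [hvm, h.symm]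
    simp [hv j h0 h1 h2, h0, h1, h2]
  have hpos : (Matrix.circulant v).PosDef := by
    rw [hvec, Matrix.circulant_add, ← conjTranspose_mul_circulant_single_add_single,
      Matrix.circulant_single]
    refine Matrix.PosDef.add_posSemidef ?_ (Matrix.posSemidef_conjTranspose_mul_self _)
    exact Matrix.PosDef.diagonal fun _ => show 0 < 2 * c - 2 by linarith
  exact ⟨hpos, hpos.isUnit⟩
end

section
/- Let r ≥ 2, n = 2r, c ∈ ℝ with c > 1, and let v : ZMod n → ℝ be the vector with v 0 = 2c, v 1 = 1, v (−1) = 1, and v j = 0 for all other j; set H = Matrix.circulant v and h(q) = (H⁻¹) 0 q. Then Σ_{q ∈ ZMod n} h(q)³ = (1/(2r)²)·Σ_{k₁=0}^{2r−1} Σ_{k₂=0}^{2r−1} 1/((2c + 2cos(k₁π/r))·(2c + 2cos(k₂π/r))·(2c + 2cos((k₁+k₂)π/r))). -/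
open ZMod
open scoped Matrix

lemma ZMod.sum_eq_sum_range {N : ℕ} [NeZero N] {M : Type*} [AddCommMonoid M] (f : ZMod N → M) :
    ∑ k, f k = ∑ m ∈ Finset.range N, f m :=
  Finset.sum_nbij' ZMod.val (fun m ↦ (m : ZMod N)) (by simp [ZMod.val_lt]) (by simp) (by simp)
    (fun m hm ↦ ZMod.val_cast_of_lt (Finset.mem_range.mp hm)) (by simp)

lemma ZMod.sum_stdAddChar_mul {N : ℕ} [NeZero N] (b : ZMod N) :
    ∑ k, stdAddChar (k * b) = if b = 0 then (N : ℂ) else 0 := by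
  simpa using AddChar.sum_mulShift b (isPrimitive_stdAddChar N)

lemma ZMod.stdAddChar_natCast_re {N : ℕ} [NeZero N] (m : ℕ) :
    (stdAddChar (m : ZMod N)).re = Real.cos (2 * Real.pi * m / N) := by
  have h := stdAddChar_coe (N := N) (m : ℤ)
  have e : 2 * (Real.pi : ℂ) * Complex.I * ((m : ℤ) : ℂ) / N
      = ((2 * Real.pi * m / N : ℝ) : ℂ) * Complex.I := by push_cast; ring
  rw [e] at h
  rw [← Int.cast_natCast, h, Complex.exp_ofReal_mul_I_re]

lemma ZMod.conj_stdAddChar {N : ℕ} [NeZero N] (k : ZMod N) :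
    (starRingEnd ℂ) (stdAddChar k) = stdAddChar (-k) :=
  (AddChar.map_neg_eq_conj _ _).symm

/-- The third moment of an inverse discrete Fourier transform. -/
lemma ZMod.sum_invDFT_pow_three {N : ℕ} [NeZero N] (F : ZMod N → ℂ) :
    ∑ q, (∑ k, stdAddChar (k * q) * F k) ^ 3 =
      N * ∑ k₁, ∑ k₂, F k₁ * F k₂ * F (-(k₁ + k₂)) := by
  have h (q : ZMod N) : (∑ k, stdAddChar (k * q) * F k) ^ 3 =
      ∑ k₁, ∑ k₂, ∑ k₃, stdAddChar (q * (k₁ + k₂ + k₃)) * (F k₁ * F k₂ * F k₃) := by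
    rw [pow_three', Finset.sum_mul_sum, Finset.sum_mul]
    refine Finset.sum_congr rfl fun k₁ _ ↦ ?_
    rw [Finset.sum_mul]
    refine Finset.sum_congr rfl fun k₂ _ ↦ ?_
    rw [Finset.mul_sum]
    refine Finset.sum_congr rfl fun k₃ _ ↦ ?_
    rw [mul_add, mul_add, AddChar.map_add_eq_mul, AddChar.map_add_eq_mul, mul_comm q, mul_comm q,
      mul_comm q]
    ring
  simp_rw [h]
  rw [Finset.sum_comm, Finset.mul_sum]
  refine Finset.sum_congr rfl fun k₁ _ ↦ ?_
  rw [Finset.sum_comm, Finset.mul_sum]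
  refine Finset.sum_congr rfl fun k₂ _ ↦ ?_
  rw [Finset.sum_comm]
  simp_rw [← Finset.sum_mul, ZMod.sum_stdAddChar_mul, add_eq_zero_iff_eq_neg']
  simp

/-- The inverse of a circulant matrix is the circulant matrix of a convolution inverse. -/
lemma Matrix.inv_circulant_of_mulVec_eq {G R : Type*} [Fintype G] [DecidableEq G] [AddGroup G]
    [CommRing R] {v u : G → R} (h : Matrix.circulant v *ᵥ u = Pi.single 0 1) :
    (Matrix.circulant v)⁻¹ = Matrix.circulant u :=
  Matrix.inv_eq_right_inv <| by rw [Matrix.circulant_mul, h, Matrix.circulant_single_one]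

lemma ZMod.circulant_mulVec_of_support {N : ℕ} [NeZero N] (hN : 3 ≤ N) {R : Type*} [CommRing R]
    {v : ZMod N → R} (hv : ∀ j, j ≠ 0 → j ≠ 1 → j ≠ -1 → v j = 0) (u : ZMod N → R) (i : ZMod N) :
    (Matrix.circulant v *ᵥ u) i = v 0 * u i + v 1 * u (i - 1) + v (-1) * u (i + 1) := by
  have : Fact (1 < N) := ⟨by omega⟩
  have : Fact (2 < N) := ⟨by omega⟩
  have h10 : (1 : ZMod N) ≠ -1 := (ZMod.neg_one_ne_one).symm
  have h : (Matrix.circulant v *ᵥ u) i = ∑ j, v j * u (i - j) := by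
    simp only [Matrix.mulVec, dotProduct, Matrix.circulant_apply]
    exact Fintype.sum_equiv (Equiv.subLeft i) _ _ (by simp)
  rw [h, ← Finset.sum_subset (Finset.subset_univ {0, 1, -1})]
  · rw [Finset.sum_insert (by simp), Finset.sum_insert (by simpa using h10), Finset.sum_singleton]
    simp [add_assoc]
  · intro j _ hj
    simp only [Finset.mem_insert, Finset.mem_singleton, not_or] at hj
    rw [hv j hj.1 hj.2.1 hj.2.2, zero_mul]

/-- The eigenvalue of the circulant matrix with diagonal `2c` and off-diagonal entries `1` at the
character indexed by `k`. -/
noncomputable def circulantEigenvalue {N : ℕ} [NeZero N] (c : ℝ) (k : ZMod N) : ℝ :=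
  2 * c + 2 * (stdAddChar k).re

lemma circulantEigenvalue_pos {N : ℕ} [NeZero N] {c : ℝ} (hc : 1 < c) (k : ZMod N) :
    0 < circulantEigenvalue c k := by
  have h := Complex.abs_re_le_norm (stdAddChar k)
  rw [AddChar.norm_apply, abs_le] at h
  unfold circulantEigenvalue
  linarith [h.1]

lemma ofReal_circulantEigenvalue {N : ℕ} [NeZero N] (c : ℝ) (k : ZMod N) :
    (circulantEigenvalue c k : ℂ) = 2 * c + (stdAddChar (-k) + stdAddChar k) := by
  rw [← ZMod.conj_stdAddChar, add_comm (starRingEnd ℂ _), Complex.add_conj]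
  simp [circulantEigenvalue]

lemma circulantEigenvalue_neg {N : ℕ} [NeZero N] (c : ℝ) (k : ZMod N) :
    circulantEigenvalue c (-k) = circulantEigenvalue c k := by
  rw [circulantEigenvalue, ← ZMod.conj_stdAddChar, Complex.conj_re, circulantEigenvalue]

/-- The fundamental solution of the circulant matrix with diagonal `2c` and off-diagonal
entries `1`, up to the factor `N`. -/
noncomputable def circulantGreen {N : ℕ} [NeZero N] (c : ℝ) (q : ZMod N) : ℂ :=
  ∑ k, stdAddChar (k * q) * (circulantEigenvalue c k : ℂ)⁻¹

lemma circulantGreen_re {N : ℕ} [NeZero N] (c : ℝ) (q : ZMod N) :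
    ((circulantGreen c q).re : ℂ) = circulantGreen c q := by
  rw [← Complex.conj_eq_iff_re, circulantGreen, map_sum]
  refine Fintype.sum_equiv (Equiv.neg _) _ _ fun k ↦ ?_
  simp [ZMod.conj_stdAddChar, circulantEigenvalue_neg]

lemma circulantGreen_recurrence {N : ℕ} [NeZero N] {c : ℝ} (hc : 1 < c) (q : ZMod N) :
    2 * c * circulantGreen c q + circulantGreen c (q - 1) + circulantGreen c (q + 1) =
      if q = 0 then (N : ℂ) else 0 := by
  rw [← ZMod.sum_stdAddChar_mul, circulantGreen, circulantGreen, circulantGreen, Finset.mul_sum,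
    ← Finset.sum_add_distrib, ← Finset.sum_add_distrib]
  refine Finset.sum_congr rfl fun k _ ↦ ?_
  have h : (circulantEigenvalue c k : ℂ) ≠ 0 := mod_cast (circulantEigenvalue_pos hc k).ne'
  have e := ofReal_circulantEigenvalue c k
  have e₁ : k * (q - 1) = k * q + -k := by ring
  have e₂ : k * (q + 1) = k * q + k := by ring
  rw [e₁, e₂, AddChar.map_add_eq_mul, AddChar.map_add_eq_mul]
  field_simp
  rw [e]
  ring

theorem stmt12 (r : ℕ) (hr : 2 ≤ r) (n : ℕ) (hn : n = 2 * r) [NeZero n]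
    (c : ℝ) (hc : 1 < c) (v : ZMod n → ℝ)
    (hv0 : v 0 = 2 * c) (hv1 : v 1 = 1) (hvm : v (-1) = 1)
    (hv : ∀ j : ZMod n, j ≠ 0 → j ≠ 1 → j ≠ -1 → v j = 0) :
    ∑ q : ZMod n, ((Matrix.circulant v)⁻¹ 0 q) ^ 3 =
      (1 / (2 * r : ℝ) ^ 2) * ∑ k₁ ∈ Finset.range (2 * r), ∑ k₂ ∈ Finset.range (2 * r),
        1 / ((2 * c + 2 * Real.cos (k₁ * Real.pi / r)) *
          (2 * c + 2 * Real.cos (k₂ * Real.pi / r)) *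
          (2 * c + 2 * Real.cos ((k₁ + k₂ : ℕ) * Real.pi / r))) := by
  have hn0 : (n : ℝ) ≠ 0 := NeZero.ne _
  have hr0 : (r : ℝ) ≠ 0 := by positivity
  have hnr : (n : ℝ) = 2 * r := by rw [hn]; push_cast; rfl
  have hinv : (Matrix.circulant v)⁻¹ =
      Matrix.circulant fun q ↦ (n : ℝ)⁻¹ * (circulantGreen c q).re := by
    refine Matrix.inv_circulant_of_mulVec_eq (funext fun i ↦ ?_)
    rw [ZMod.circulant_mulVec_of_support (by omega) hv, hv0, hv1, hvm, Pi.single_apply]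
    have h := circulantGreen_recurrence hc i
    rw [← circulantGreen_re, ← circulantGreen_re c (i - 1), ← circulantGreen_re c (i + 1)] at h
    have h' : 2 * c * (circulantGreen c i).re + (circulantGreen c (i - 1)).re
        + (circulantGreen c (i + 1)).re = if i = 0 then (n : ℝ) else 0 := by
      apply Complex.ofReal_injective
      rw [apply_ite Complex.ofReal]
      push_cast
      exact h
    rw [show (if i = 0 then (1 : ℝ) else 0) = (n : ℝ)⁻¹ * if i = 0 then (n : ℝ) else 0 by
      split_ifs <;> simp [hn0], ← h']
    ring
  have hsum : ∑ q : ZMod n, (circulantGreen c q).re ^ 3 = n * ∑ k₁ : ZMod n, ∑ k₂ : ZMod n,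
      1 / (circulantEigenvalue c k₁ * circulantEigenvalue c k₂ *
        circulantEigenvalue c (k₁ + k₂)) := by
    have h : ∑ q : ZMod n, circulantGreen c q ^ 3 = _ :=
      ZMod.sum_invDFT_pow_three fun k : ZMod n ↦ (circulantEigenvalue c k : ℂ)⁻¹
    simp_rw [circulantEigenvalue_neg, ← mul_inv, ← one_div] at h
    apply Complex.ofReal_injective
    push_cast
    simp_rw [circulantGreen_re]
    exact h
  have heig (m : ℕ) : circulantEigenvalue c (m : ZMod n) =
      2 * c + 2 * Real.cos (m * Real.pi / r) := by
    rw [circulantEigenvalue, ZMod.stdAddChar_natCast_re, hnr]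
    congr 3
    field_simp
  calc ∑ q : ZMod n, ((Matrix.circulant v)⁻¹ 0 q) ^ 3
      = ∑ q : ZMod n, ((n : ℝ)⁻¹ * (circulantGreen c q).re) ^ 3 := by
        rw [hinv]
        exact Fintype.sum_equiv (Equiv.neg _) _ _ (by simp [Matrix.circulant_apply])
    _ = 1 / (n : ℝ) ^ 2 * ∑ k₁ : ZMod n, ∑ k₂ : ZMod n,
          1 / (circulantEigenvalue c k₁ * circulantEigenvalue c k₂ *
            circulantEigenvalue c (k₁ + k₂)) := by
        simp_rw [mul_pow]
        rw [← Finset.mul_sum, hsum]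
        field_simp
    _ = _ := by
        rw [hnr, ← hn]
        simp_rw [ZMod.sum_eq_sum_range, ← Nat.cast_add, heig]
end
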